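/- If a binary matrix x on {1,...,n} satisfies the in-degree and out-degree constraints (exactly one outgoing and one incoming arc per node, no self-loops) and contains no directed cycle avoiding node 1, then x is the arc set of a single Hamiltonian cycle through all n nodes. -/

import Mathlib

/-- A finite family of naturals with sum one takes the value one exactly once. -/
theorem existsUnique_eq_one_of_sum_eq_one {ι : Type*} [Fintype ι] {f : ι → ℕ}
    (h : ∑ i, f i = 1) : ∃! i, f i = 1 := by
  classical
  obtain ⟨j, -, hj⟩ := Finset.exists_ne_zero_of_sum_ne_zero (h.trans_ne one_ne_zero)
  have hsum := Finset.add_sum_erase Finset.univ f (Finset.mem_univ j)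
  have hrest : ∑ i ∈ Finset.univ.erase j, f i = 0 := by omega
  refine ⟨j, show f j = 1 by omega, fun i (hi : f i = 1) => ?_⟩
  by_contra hij
  have := Finset.sum_eq_zero_iff.mp hrest i (by simp [hij])
  omega

/-- A matrix of naturals with unit row and column sums is a permutation matrix. -/
theorem exists_perm_of_sum_eq_one {ι : Type*} [Fintype ι] {x : ι → ι → ℕ}
    (hrow : ∀ i, ∑ j, x i j = 1) (hcol : ∀ j, ∑ i, x i j = 1) :
    ∃ σ : Equiv.Perm ι, ∀ i j, x i j = 1 ↔ σ i = j := by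
  choose f hf hfu using fun i => existsUnique_eq_one_of_sum_eq_one (hrow i)
  have hinj : Function.Injective f := fun i i' h =>
    (existsUnique_eq_one_of_sum_eq_one (hcol (f i))).unique (hf i) (h ▸ hf i')
  refine ⟨Equiv.ofBijective f (Finite.injective_iff_bijective.mp hinj), fun i j => ?_⟩
  exact ⟨fun h => (hfu i j h).symm, fun h => h ▸ hf i⟩

/-- If a binary matrix satisfies the degree constraints (no self-loops, exactly one outgoing
and one incoming arc per node) and has no directed cycle avoiding the depot (node `0`),
then its arcs form a single Hamiltonian cycle through all `n` nodes, i.e. they are the graph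
of a cyclic permutation of `Fin n`. -/
theorem degree_and_no_subtour_implies_hamiltonian (n : ℕ) (hn : 2 ≤ n) [NeZero n]
    (x : Fin n → Fin n → ℕ)
    (hbin : ∀ i j, x i j = 0 ∨ x i j = 1)
    (hdiag : ∀ i, x i i = 0)
    (hout : ∀ i : Fin n, ∑ j : Fin n, x i j = 1)
    (hin : ∀ j : Fin n, ∑ i : Fin n, x i j = 1)
    (hnosub : ¬ ∃ (k : ℕ) (v : ℕ → Fin n), 0 < k ∧
      (∀ a b, a < k → b < k → a ≠ b → v a ≠ v b) ∧
      (∀ a, a < k → v a ≠ 0) ∧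
      (∀ a, a < k → x (v a) (v ((a + 1) % k)) = 1)) :
    ∃ σ : Equiv.Perm (Fin n), σ.IsCycle ∧ σ.support = Finset.univ ∧
      ∀ i j, x i j = 1 ↔ σ i = j := by
  obtain ⟨σ, hσ⟩ := exists_perm_of_sum_eq_one hout hin
  have hmove : ∀ i, σ i ≠ i := fun i h => by simpa [hdiag i] using (hσ i i).mpr h
  have hsame : ∀ i, σ.SameCycle 0 i := by
    intro i
    by_contra hi
    refine hnosub ⟨Function.minimalPeriod σ i, fun a => σ^[a] i, ?_, ?_, ?_, ?_⟩
    · exact Function.minimalPeriod_pos_of_mem_periodicPts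
        (Function.Injective.mem_periodicPts σ.injective i)
    · exact fun a b ha hb hab h =>
        hab (Function.iterate_injOn_Iio_minimalPeriod ha hb h)
    · intro a _ ha
      refine hi (Equiv.Perm.SameCycle.symm ⟨a, ?_⟩)
      simpa [Equiv.Perm.iterate_eq_pow] using ha
    · intro a _
      simp only [hσ, Function.iterate_mod_minimalPeriod_eq, Function.iterate_succ_apply']
  exact ⟨σ, ⟨0, hmove 0, fun i _ => hsame i⟩, by ext i; simp [hmove i], hσ⟩
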